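/- arXiv:1504.02986 — 2 statements merged into one kernel-verified Lean document; each statement's English description precedes it below -/
import Mathlib

section
/- (Linear growth bound from the Schwarz Lemma, claim (3.8) of the paper.) For every β ∈ (0,1) there exists A ≥ 1 with the following property. Let φ : ℂ → ℂ be holomorphic and injective on the slit plane Ω = ℂ ∖ (−∞,0], with φ(Ω) ⊆ Ω, with φ mapping (0,∞) into (0,∞), and with φ(1) = 1. Then for every z ∈ Ω with |z| ≥ 1 and |arg z| ≤ π(1−β) one has |φ(z)| ≤ A·|z|. -/
open Complex Real

/-- The principal square root. -/
noncomputable def rt (z : ℂ) : ℂ := Complex.exp (Complex.log z / 2)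

lemma rt_sq {z : ℂ} (hz : z ≠ 0) : rt z ^ 2 = z := by
  rw [rt, ← Complex.exp_nat_mul]
  push_cast
  rw [mul_div_cancel₀ _ (two_ne_zero), Complex.exp_log hz]

lemma rt_re (z : ℂ) : (rt z).re = ‖rt z‖ * Real.cos (Complex.arg z / 2) := by
  have h : (Complex.log z / 2).im = Complex.arg z / 2 := by
    simp [← Complex.log_im]
  rw [rt, Complex.norm_exp, Complex.exp_re, h]

lemma rt_re_pos {z : ℂ} (hz : z ∈ Complex.slitPlane) : 0 < (rt z).re := by
  rw [rt_re]
  have h1 := Complex.neg_pi_lt_arg z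
  have h2 : Complex.arg z < π :=
    lt_of_le_of_ne (Complex.arg_le_pi z) (Complex.mem_slitPlane_iff_arg.1 hz).1
  have h3 : 0 < ‖rt z‖ := norm_pos_iff.2 (Complex.exp_ne_zero _)
  exact mul_pos h3 (Real.cos_pos_of_mem_Ioo ⟨by linarith, by linarith⟩)

lemma rt_diff {z : ℂ} (hz : z ∈ Complex.slitPlane) : DifferentiableAt ℂ rt z := by
  unfold rt
  exact ((Complex.differentiableAt_log hz).div_const 2).cexp

lemma sq_slit {v : ℂ} (hv : 0 < v.re) : v ^ 2 ∈ Complex.slitPlane := by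
  rw [Complex.mem_slitPlane_iff]
  by_cases h : v.im = 0
  · left
    simp [pow_two, h]
    exact hv.ne'
  · right
    simp only [pow_two, Complex.mul_im]
    intro h'
    have : v.re * v.im = 0 := by linarith
    rcases mul_eq_zero.1 this with h1 | h1
    · exact hv.ne' h1
    · exact h h1

lemma cay_den {u : ℂ} (hu : 0 < u.re) : u + 1 ≠ 0 := by
  intro h
  have := congrArg Complex.re h
  simp at this
  linarith

lemma cay_norm {u : ℂ} (hu : 0 < u.re) :
    (1 - ‖(u - 1) / (u + 1)‖ ^ 2) * ‖u + 1‖ ^ 2 = 4 * u.re := by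
  have h : ‖u + 1‖ ≠ 0 := norm_ne_zero_iff.2 (cay_den hu)
  rw [norm_div, div_pow, sub_mul, div_mul_cancel₀ _ (pow_ne_zero 2 h)]
  rw [← Complex.normSq_eq_norm_sq, ← Complex.normSq_eq_norm_sq]
  simp [Complex.normSq_apply]
  ring

lemma cay_lt {u : ℂ} (hu : 0 < u.re) : ‖(u - 1) / (u + 1)‖ < 1 := by
  have h := cay_norm hu
  by_contra! hc
  have : 1 ≤ ‖(u - 1) / (u + 1)‖ ^ 2 := one_le_pow₀ hc
  nlinarith [sq_nonneg ‖u + 1‖]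

lemma inv_den {w : ℂ} (hw : ‖w‖ < 1) : 1 - w ≠ 0 := by
  intro h
  have : w = 1 := (sub_eq_zero.1 h).symm
  simp [this] at hw

lemma inv_re {w : ℂ} (hw : ‖w‖ < 1) : 0 < ((1 + w) / (1 - w)).re := by
  have h : 0 < Complex.normSq (1 - w) := Complex.normSq_pos.2 (inv_den hw)
  have h2 : w.re * w.re + w.im * w.im < 1 := by
    rw [← Complex.normSq_apply, Complex.normSq_eq_norm_sq]
    nlinarith [norm_nonneg w]
  rw [Complex.div_re, ← add_div]
  apply div_pos _ h
  simp
  nlinarith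

/-- Schwarz's lemma transported to the slit plane. -/
lemma key (φ : ℂ → ℂ) (hd : ∀ z ∈ Complex.slitPlane, DifferentiableAt ℂ φ z)
    (hm : Set.MapsTo φ Complex.slitPlane Complex.slitPlane) (h1 : φ 1 = 1)
    {z : ℂ} (hz : z ∈ Complex.slitPlane) :
    ‖(rt (φ z) - 1) / (rt (φ z) + 1)‖ ≤ ‖(rt z - 1) / (rt z + 1)‖ := by
  set w := (rt z - 1) / (rt z + 1) with hw
  let f : ℂ → ℂ := fun w => (rt (φ (((1 + w) / (1 - w)) ^ 2)) - 1) /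
    (rt (φ (((1 + w) / (1 - w)) ^ 2)) + 1)
  have hsl : ∀ w : ℂ, ‖w‖ < 1 → ((1 + w) / (1 - w)) ^ 2 ∈ Complex.slitPlane :=
    fun w hw => sq_slit (inv_re hw)
  have hwz : ((1 + w) / (1 - w)) ^ 2 = z := by
    rw [← rt_sq (Complex.slitPlane_ne_zero hz)]
    congr 1
    have h := cay_den (rt_re_pos hz)
    rw [div_eq_iff (inv_den (cay_lt (rt_re_pos hz))), hw]
    field_simp
    ring
  have hfd : DifferentiableOn ℂ f (Metric.ball 0 1) := by
    intro w hw
    rw [mem_ball_zero_iff] at hw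
    apply DifferentiableAt.differentiableWithinAt
    have ha : DifferentiableAt ℂ (fun w : ℂ => ((1 + w) / (1 - w)) ^ 2) w :=
      (((differentiableAt_const _).add differentiableAt_id).div
        ((differentiableAt_const _).sub differentiableAt_id) (inv_den hw)).pow 2
    have hb : DifferentiableAt ℂ (fun w : ℂ => φ (((1 + w) / (1 - w)) ^ 2)) w :=
      DifferentiableAt.comp (g := φ) w (hd _ (hsl w hw)) ha
    have hc : DifferentiableAt ℂ (fun w : ℂ => rt (φ (((1 + w) / (1 - w)) ^ 2))) w :=
      DifferentiableAt.comp (g := rt) w (rt_diff (hm (hsl w hw))) hb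
    exact (hc.sub_const 1).div (hc.add_const 1) (cay_den (rt_re_pos (hm (hsl w hw))))
  have hfm : Set.MapsTo f (Metric.ball 0 1) (Metric.ball 0 1) := by
    intro w hw
    rw [mem_ball_zero_iff] at hw ⊢
    exact cay_lt (rt_re_pos (hm (hsl w hw)))
  have hf0 : f 0 = 0 := by simp [f, h1, rt]
  have := Complex.norm_le_norm_of_mapsTo_ball hfd (hfm.mono_right Metric.ball_subset_closedBall) hf0 (z := w) (cay_lt (rt_re_pos hz))
  simpa only [f, hwz] using this

lemma growth {s u : ℂ} {c : ℝ} (hc : 0 < c) (hs : 0 < s.re) (hu : 1 ≤ ‖u‖)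
    (hcu : ‖u‖ * c ≤ u.re)
    (h : ‖(s - 1) / (s + 1)‖ ≤ ‖(u - 1) / (u + 1)‖) : ‖s‖ * c ≤ 4 * ‖u‖ := by
  have hu0 : 0 < u.re := lt_of_lt_of_le (by positivity) hcu
  have e := cay_norm hu0
  have l := cay_lt hu0
  set r := ‖(u - 1) / (u + 1)‖ with hr
  have r0 : 0 ≤ r := norm_nonneg _
  have hsp : 0 < ‖s + 1‖ := norm_pos_iff.2 (cay_den hs)
  rw [norm_div, div_le_iff₀ hsp] at h
  have a1 : ‖s‖ - 1 ≤ ‖s - 1‖ := by simpa using norm_sub_norm_le s 1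
  have a2 : ‖s + 1‖ ≤ ‖s‖ + 1 := by simpa using norm_add_le s 1
  have a3 : ‖u + 1‖ ≤ 2 * ‖u‖ := by
    have := norm_add_le u 1
    simp at this
    linarith
  have b1 : ‖s‖ * (1 - r) ≤ 1 + r := by nlinarith
  have b2 : ‖u + 1‖ ^ 2 ≤ 4 * ‖u‖ ^ 2 := by
    nlinarith [norm_nonneg (u + 1)]
  have b3 : ‖u‖ * c ≤ (1 - r ^ 2) * ‖u‖ ^ 2 := by
    have : 0 ≤ 1 - r ^ 2 := by nlinarith
    nlinarith
  have b4 : c ≤ (1 - r ^ 2) * ‖u‖ := by nlinarith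
  have b5 : ‖s‖ * (1 - r ^ 2) ≤ 4 := by nlinarith
  calc ‖s‖ * c ≤ ‖s‖ * ((1 - r ^ 2) * ‖u‖) := by gcongr
    _ = (‖s‖ * (1 - r ^ 2)) * ‖u‖ := by ring
    _ ≤ 4 * ‖u‖ := by gcongr

/-- Linear growth bound from the Schwarz Lemma: for every `β ∈ (0,1)` there is `A ≥ 1`
such that any holomorphic injective self-map `φ` of the slit plane preserving the
positive real axis and fixing `1` satisfies `|φ(z)| ≤ A·|z|` in the sector
`|arg z| ≤ π(1−β)`, `|z| ≥ 1`. -/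
theorem schwarz_linear_growth :
    ∀ β : ℝ, β ∈ Set.Ioo (0 : ℝ) 1 → ∃ A : ℝ, 1 ≤ A ∧
      ∀ φ : ℂ → ℂ,
        (∀ z ∈ Complex.slitPlane, DifferentiableAt ℂ φ z) →
        Set.InjOn φ Complex.slitPlane →
        Set.MapsTo φ Complex.slitPlane Complex.slitPlane →
        (∀ x : ℝ, 0 < x → (φ x).im = 0 ∧ 0 < (φ x).re) →
        φ 1 = 1 →
        ∀ z ∈ Complex.slitPlane, 1 ≤ ‖z‖ → |Complex.arg z| ≤ π * (1 - β) →
          ‖φ z‖ ≤ A * ‖z‖ := by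
  intro β hβ
  obtain ⟨hβ0, hβ1⟩ := hβ
  have hpi := Real.pi_pos
  set c := Real.cos (π * (1 - β) / 2) with hcdef
  have hc : 0 < c := Real.cos_pos_of_mem_Ioo ⟨by nlinarith, by nlinarith⟩
  have hc1 : c ≤ 1 := Real.cos_le_one _
  have hA : 1 ≤ 16 / c ^ 2 := by
    rw [le_div_iff₀ (by positivity)]
    nlinarith
  refine ⟨16 / c ^ 2, hA, ?_⟩
  intro φ hd _ hm _ h1 z hz hz1 harg
  have hnz : ‖rt z‖ ^ 2 = ‖z‖ := by
    rw [← norm_pow, rt_sq (Complex.slitPlane_ne_zero hz)]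
  have hnf : ‖rt (φ z)‖ ^ 2 = ‖φ z‖ := by
    rw [← norm_pow, rt_sq (Complex.slitPlane_ne_zero (hm hz))]
  have hu : 1 ≤ ‖rt z‖ := by
    nlinarith [norm_nonneg (rt z)]
  have hcu : ‖rt z‖ * c ≤ (rt z).re := by
    rw [rt_re]
    apply mul_le_mul_of_nonneg_left _ (norm_nonneg _)
    rw [← Real.cos_abs (Complex.arg z / 2), abs_div, abs_two]
    apply Real.cos_le_cos_of_nonneg_of_le_pi
    · positivity
    · nlinarith
    · linarith
  have g := growth hc (rt_re_pos (hm hz)) hu hcu (key φ hd hm h1 hz)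
  have g2 : (‖rt (φ z)‖ * c) ^ 2 ≤ (4 * ‖rt z‖) ^ 2 := by gcongr
  rw [mul_pow, mul_pow, hnz, hnf] at g2
  rw [div_mul_eq_mul_div, le_div_iff₀ (by positivity)]
  linarith
end

section
/- (Global logarithmic lower bound for the hyperbolic distance, used in the Schwarz Lemma growth estimate.) There exists a constant C > 0 such that for every point z of the upper half-plane ℍ, the hyperbolic distance from the base point i satisfies dist(i, z) ≥ log|z| − C, where |z| is the Euclidean absolute value of z as a complex number. -/
open UpperHalfPlane

/-- Global logarithmic lower bound for the hyperbolic distance in the upper half-plane: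
`dist(i, z) ≥ log |z| − C` for a universal constant `C`. -/
theorem hyperbolic_dist_ge_log_sub_const :
    ∃ C > (0 : ℝ), ∀ z : ℍ,
      Real.log ‖(z : ℂ)‖ - C ≤ dist UpperHalfPlane.I z := by
  refine ⟨1, one_pos, fun z => ?_⟩
  have h := UpperHalfPlane.dist_coe_le z UpperHalfPlane.I
  rw [UpperHalfPlane.I_im, one_mul, dist_comm z, dist_eq_norm] at h
  have h2 : ‖(z : ℂ)‖ ≤ ‖(z : ℂ) - (UpperHalfPlane.I : ℍ)‖ + ‖((UpperHalfPlane.I : ℍ) : ℂ)‖ := by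
    simpa using norm_add_le ((z : ℂ) - (UpperHalfPlane.I : ℍ)) ((UpperHalfPlane.I : ℍ) : ℂ)
  have h3 : ‖((UpperHalfPlane.I : ℍ) : ℂ)‖ = 1 := by simp
  have h4 : Real.log ‖(z : ℂ)‖ ≤ dist UpperHalfPlane.I z := by
    rw [Real.log_le_iff_le_exp (norm_pos_iff.mpr z.ne_zero)]
    linarith
  linarith
end
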